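/- For every decorated tree τ with w(τ) > 1 and every seed tree S, the squared increments satisfy E[(D_τ(T_{n+1}^{(S)}) − D_τ(T_n^{(S)}))²] ≪ n^{w(τ) − 3/2}. -/

import Mathlib

open Finset

noncomputable section

namespace LPAM

attribute [local instance] Classical.propDecidable

/-- The tree obtained from `G` by attaching a new vertex (the last element of `Fin (n+1)`)
to the vertex `v` of `G`. -/
def attach {n : ℕ} (G : SimpleGraph (Fin n)) (v : Fin n) : SimpleGraph (Fin (n + 1)) :=
  SimpleGraph.fromRel fun a b =>
    (∃ a' b' : Fin n, a = a'.castSucc ∧ b = b'.castSucc ∧ G.Adj a' b') ∨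
    (a = Fin.last n ∧ b = v.castSucc)

/-- The degree of a vertex. -/
def deg {n : ℕ} (G : SimpleGraph (Fin n)) (v : Fin n) : ℕ := (G.neighborSet v).ncard

/-- The law of the linear preferential attachment tree after `k` steps started from the
seed `S`: at each step, a new vertex is joined by an edge to a random vertex of the current
tree chosen with probability proportional to its degree. -/
def law {n₀ : ℕ} (S : SimpleGraph (Fin n₀)) : (k : ℕ) → SimpleGraph (Fin (n₀ + k)) → ℝ
  | 0, G => if G = S then 1 else 0
  | (k + 1), G =>
      ∑ H : SimpleGraph (Fin (n₀ + k)), ∑ v : Fin (n₀ + k),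
        law S k H * ((deg H v : ℝ) / (2 * (n₀ + k : ℕ) - 2)) *
          (if attach H v = G then 1 else 0)

/-- The law of the preferential attachment tree `T_n^{(S)}` with seed `S`, as a function on
graphs on `Fin n` (zero if `n < |S|`). -/
def lawAt {n₀ : ℕ} (S : SimpleGraph (Fin n₀)) (n : ℕ) (G : SimpleGraph (Fin n)) : ℝ :=
  if h : n₀ ≤ n then
    law S (n - n₀) (cast (congrArg (fun m => SimpleGraph (Fin m)) (Nat.add_sub_cancel' h).symm) G)
  else 0

/-- A decorated tree: a finite tree together with a positive integer label on each vertex. -/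
structure DecTree where
  n : ℕ
  graph : SimpleGraph (Fin n)
  isTree : graph.IsTree
  label : Fin n → ℕ
  label_pos : ∀ u, 0 < label u

/-- The weight of a decorated tree: the sum of its labels. -/
def DecTree.weight (τ : DecTree) : ℕ := ∑ u, τ.label u

/-- The strict partial order `≺` on decorated trees. -/
def DecTree.lt (τ' τ : DecTree) : Prop :=
  (τ'.weight < τ.weight ∧ τ'.n ≤ τ.n) ∨ (τ'.weight = τ.weight ∧ τ'.n < τ.n)

/-- The partial order `⪯` associated with `≺`. -/
def DecTree.le (τ' τ : DecTree) : Prop := DecTree.lt τ' τ ∨ τ' = τ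

/-- The observable `D_τ(T) = ∑_φ ∏_{u ∈ τ} [deg_T φ(u)]_{ℓ(u)}`, the sum running over all
embeddings (injective graph homomorphisms) `φ : τ → T`. -/
def Dval (τ : DecTree) {m : ℕ} (T : SimpleGraph (Fin m)) : ℝ :=
  ∑ φ : Fin τ.n → Fin m,
    if Function.Injective φ ∧ ∀ a b, τ.graph.Adj a b → T.Adj (φ a) (φ b) then
      ∏ u, ((deg T (φ u)).descFactorial (τ.label u) : ℝ)
    else 0

/-- The expectation `E[D_τ(T_n^{(S)})]`. -/
def expD {n₀ : ℕ} (S : SimpleGraph (Fin n₀)) (τ : DecTree) (n : ℕ) : ℝ :=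
  ∑ G : SimpleGraph (Fin n), lawAt S n G * Dval τ G

/-- `a ≪ b` : there are `c > 0` and `γ ∈ ℝ` with `|a_n| ≤ c (log n)^γ |b_n|` for `n` large. -/
def Lsim (a b : ℕ → ℝ) : Prop :=
  ∃ c γ : ℝ, 0 < c ∧ ∀ᶠ n : ℕ in Filter.atTop, |a n| ≤ c * Real.log n ^ γ * |b n|

end LPAM

namespace LPAM

/-- The expectation `E[(D_τ(T_{n+1}^{(S)}) − D_τ(T_n^{(S)}))²]`, computed by conditioning on
`T_n^{(S)} = G` and on the vertex `v` to which the new vertex is attached. -/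
def expIncrSq {n₀ : ℕ} (S : SimpleGraph (Fin n₀)) (τ : DecTree) (n : ℕ) : ℝ :=
  ∑ G : SimpleGraph (Fin n), ∑ v : Fin n,
    lawAt S n G * ((deg G v : ℝ) / (2 * (n : ℝ) - 2)) *
      (Dval τ (attach G v) - Dval τ G) ^ 2

section Auxiliary

attribute [local instance] Classical.propDecidable

/-! ### Degrees after attaching a leaf -/

lemma attach_adj_castSucc {n : ℕ} (G : SimpleGraph (Fin n)) (v a b : Fin n) :
    (attach G v).Adj a.castSucc b.castSucc ↔ G.Adj a b := by
  constructor
  · rintro ⟨-, (⟨a', b', ha, hb, h⟩ | ⟨h, -⟩) | (⟨a', b', ha, hb, h⟩ | ⟨h, -⟩)⟩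
    · rwa [Fin.castSucc_injective _ ha, Fin.castSucc_injective _ hb]
    · exact absurd h (Fin.castSucc_lt_last _).ne
    · rw [Fin.castSucc_injective _ ha, Fin.castSucc_injective _ hb]
      exact h.symm
    · exact absurd h (Fin.castSucc_lt_last _).ne
  · intro h
    exact ⟨fun e => h.ne (Fin.castSucc_injective _ e), Or.inl (Or.inl ⟨a, b, rfl, rfl, h⟩)⟩

lemma attach_adj_last {n : ℕ} (G : SimpleGraph (Fin n)) (v a : Fin n) :
    (attach G v).Adj (Fin.last n) a.castSucc ↔ a = v := by
  constructor
  · rintro ⟨-, (⟨a', b', ha, hb, h⟩ | ⟨-, h⟩) | (⟨a', b', ha, hb, h⟩ | ⟨h, -⟩)⟩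
    · exact absurd ha.symm (Fin.castSucc_lt_last _).ne
    · exact Fin.castSucc_injective _ h
    · exact absurd hb.symm (Fin.castSucc_lt_last _).ne
    · exact absurd h (Fin.castSucc_lt_last _).ne
  · rintro rfl
    exact ⟨(Fin.castSucc_lt_last _).ne', Or.inl (Or.inr ⟨rfl, rfl⟩)⟩

lemma deg_eq_card {n : ℕ} (G : SimpleGraph (Fin n)) (x : Fin n) :
    deg G x = ∑ y, if G.Adj x y then 1 else 0 := by
  rw [deg, Set.ncard_eq_toFinset_card', Finset.sum_boole]
  simp only [Nat.cast_id]
  congr 1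
  ext y
  simp

lemma deg_attach_castSucc {n : ℕ} (G : SimpleGraph (Fin n)) (v x : Fin n) :
    deg (attach G v) x.castSucc = deg G x + if x = v then 1 else 0 := by
  rw [deg_eq_card, deg_eq_card, Fin.sum_univ_castSucc]
  simp only [attach_adj_castSucc, SimpleGraph.adj_comm _ x.castSucc (Fin.last n), attach_adj_last]

lemma deg_attach_last {n : ℕ} (G : SimpleGraph (Fin n)) (v : Fin n) :
    deg (attach G v) (Fin.last n) = 1 := by
  rw [deg_eq_card, Fin.sum_univ_castSucc]
  simp [attach_adj_last]

lemma sum_deg_attach {n : ℕ} (G : SimpleGraph (Fin n)) (v : Fin n) :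
    ∑ x, deg (attach G v) x = ∑ x, deg G x + 2 := by
  rw [Fin.sum_univ_castSucc]
  simp [deg_attach_castSucc, deg_attach_last, Finset.sum_add_distrib]

lemma sum_deg_of_isTree {n : ℕ} {G : SimpleGraph (Fin n)} (hG : G.IsTree) :
    ∑ x, deg G x + 2 = 2 * n := by
  have h1 := G.sum_degrees_eq_twice_card_edges
  have h2 := hG.card_edgeFinset
  have h3 : ∀ x, deg G x = G.degree x := fun x => by
    rw [deg_eq_card, ← SimpleGraph.card_neighborFinset_eq_degree, Finset.sum_boole]
    simp only [Nat.cast_id]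
    congr 1
    ext y
    simp
  simp only [h3]
  rw [Fintype.card_fin] at h2
  omega

/-! ### Factorial powers -/

lemma mul_ascFactorial_add_indicator (d m : ℕ) :
    d * (d + 1).ascFactorial m = d.ascFactorial m * (d + m) := by
  rw [Nat.succ_ascFactorial, mul_comm]

lemma ascFactorial_mono_base {a b : ℕ} (h : a ≤ b) (m : ℕ) :
    a.ascFactorial m ≤ b.ascFactorial m := by
  induction m with
  | zero => simp
  | succ m ih =>
    rw [Nat.ascFactorial_succ, Nat.ascFactorial_succ]
    gcongr

lemma ascFactorial_mul_le (d a b : ℕ) :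
    d.ascFactorial a * d.ascFactorial b ≤ d.ascFactorial (a + b) := by
  rw [← Nat.ascFactorial_mul_ascFactorial]
  exact Nat.mul_le_mul_left _ (ascFactorial_mono_base (Nat.le_add_right _ _) _)

lemma descFactorial_le_ascFactorial (d m : ℕ) : d.descFactorial m ≤ d.ascFactorial m :=
  (Nat.descFactorial_le_pow d m).trans (Nat.pow_succ_le_ascFactorial d m)

lemma succ_descFactorial_add (d m : ℕ) :
    (d + 1).descFactorial (m + 1) = d.descFactorial (m + 1) + (m + 1) * d.descFactorial m := by
  rw [Nat.succ_descFactorial_succ, Nat.descFactorial_succ]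
  rcases le_or_gt m d with h | h
  · obtain ⟨c, rfl⟩ := Nat.exists_eq_add_of_le h
    rw [Nat.add_sub_cancel_left]
    ring
  · rw [Nat.descFactorial_of_lt h]
    ring

lemma succ_descFactorial_le {d : ℕ} (hd : 0 < d) (m : ℕ) :
    (d + 1).descFactorial (m + 1) ≤ 2 * d.ascFactorial (m + 1) := by
  rw [Nat.succ_descFactorial_succ]
  have h1 := Nat.descFactorial_le_pow d m
  have h2 := Nat.pow_succ_le_ascFactorial d (m + 1)
  calc (d + 1) * d.descFactorial m ≤ (2 * d) * d ^ m := by gcongr; omega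
    _ = 2 * d ^ (m + 1) := by ring
    _ ≤ _ := by gcongr

/-! ### Vertex sets without empty cuts -/

/-- The vertex set `A` induces a connected (or empty) subgraph of `G`: every partition of `A`
into two nonempty parts is crossed by an edge. -/
def Uncut {n : ℕ} (G : SimpleGraph (Fin n)) (A : Finset (Fin n)) : Prop :=
  ∀ B ⊆ A, B.Nonempty → B ≠ A → ∃ a ∈ B, ∃ b ∈ A, b ∉ B ∧ G.Adj a b

lemma Uncut.union {n : ℕ} {G : SimpleGraph (Fin n)} {A A' : Finset (Fin n)}
    (h : Uncut G A) (h' : Uncut G A') {v : Fin n} (hv : v ∈ A) (hv' : v ∈ A') :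
    Uncut G (A ∪ A') := by
  intro B hB hne hneq
  by_contra hcon
  have key : ∀ C : Finset (Fin n), Uncut G C → C ⊆ A ∪ A' → (B ∩ C).Nonempty → C ⊆ B := by
    intro C hC hCA hBC
    by_contra hsub
    obtain ⟨a, ha, b, hb, hbn, hab⟩ := hC (B ∩ C) inter_subset_right hBC
      (fun e => hsub (inter_eq_right.1 e))
    exact hcon ⟨a, (mem_inter.1 ha).1, b, hCA hb, fun hbB => hbn (mem_inter.2 ⟨hbB, hb⟩), hab⟩
  have hA := key A h subset_union_left
  have hA' := key A' h' subset_union_right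
  apply hneq
  apply subset_antisymm hB
  obtain ⟨x, hx⟩ := hne
  rcases mem_union.1 (hB hx) with hxA | hxA
  · have h1 := hA ⟨x, mem_inter.2 ⟨hx, hxA⟩⟩
    exact union_subset h1 (hA' ⟨v, mem_inter.2 ⟨h1 hv, hv'⟩⟩)
  · have h1 := hA' ⟨x, mem_inter.2 ⟨hx, hxA⟩⟩
    exact union_subset (hA ⟨v, mem_inter.2 ⟨h1 hv', hv⟩⟩) h1

lemma uncut_of_attach {n : ℕ} {G : SimpleGraph (Fin n)} {v : Fin n} {A : Finset (Fin n)}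
    (h : Uncut (attach G v) (A.map Fin.castSuccEmb)) : Uncut G A := by
  intro B hB hne hneq
  obtain ⟨a, ha, b, hb, hbn, hab⟩ := h (B.map Fin.castSuccEmb) (map_subset_map.2 hB)
    (hne.map) (fun e => hneq (map_injective _ e))
  obtain ⟨a', ha', rfl⟩ := mem_map.1 ha
  obtain ⟨b', hb', rfl⟩ := mem_map.1 hb
  exact ⟨a', ha', b', hb', fun hh => hbn (mem_map_of_mem _ hh), (attach_adj_castSucc _ _ _ _).1 hab⟩

lemma mem_of_uncut_attach {n : ℕ} {G : SimpleGraph (Fin n)} {v : Fin n} {A : Finset (Fin n)}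
    (hA : A.Nonempty)
    (h : Uncut (attach G v) (insert (Fin.last n) (A.map Fin.castSuccEmb))) : v ∈ A := by
  obtain ⟨a, ha, b, hb, hbn, hab⟩ := h {Fin.last n} (by simp) (by simp) (by
    obtain ⟨x, hx⟩ := hA
    intro e
    have : x.castSucc ∈ ({Fin.last n} : Finset (Fin (n + 1))) := by
      rw [e]
      exact mem_insert_of_mem (mem_map_of_mem Fin.castSuccEmb hx)
    exact (Fin.castSucc_lt_last x).ne (mem_singleton.1 this))
  rw [mem_singleton] at ha hbn
  subst ha
  obtain ⟨b', hb', rfl⟩ := mem_map.1 ((mem_insert.1 hb).resolve_left hbn)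
  rwa [← (attach_adj_last _ _ _).1 hab]

lemma uncut_of_attach_insert {n : ℕ} {G : SimpleGraph (Fin n)} {v : Fin n}
    {A : Finset (Fin n)}
    (h : Uncut (attach G v) (insert (Fin.last n) (A.map Fin.castSuccEmb))) : Uncut G A := by
  have hlast : ∀ C : Finset (Fin n), Fin.last n ∉ C.map Fin.castSuccEmb := by
    intro C hC
    obtain ⟨x, -, hx⟩ := mem_map.1 hC
    exact (Fin.castSucc_lt_last x).ne hx
  intro B hB hne hneq
  have hBA := map_subset_map (f := Fin.castSuccEmb).2 hB
  by_cases hv : v ∈ B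
  · obtain ⟨a, ha, b, hb, hbn, hab⟩ := h (insert (Fin.last n) (B.map Fin.castSuccEmb))
      (insert_subset_insert _ hBA) (by simp) (by
        intro e
        apply hneq
        apply map_injective Fin.castSuccEmb
        rw [← erase_insert (hlast B), ← erase_insert (hlast A), e])
    rw [mem_insert, not_or] at hbn
    obtain ⟨b', hb', rfl⟩ := mem_map.1 ((mem_insert.1 hb).resolve_left hbn.1)
    rcases mem_insert.1 ha with rfl | ha
    · rw [Fin.coe_castSuccEmb, attach_adj_last] at hab
      exact absurd (mem_map_of_mem _ (hab ▸ hv)) hbn.2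
    · obtain ⟨a', ha', rfl⟩ := mem_map.1 ha
      exact ⟨a', ha', b', hb', fun hh => hbn.2 (mem_map_of_mem _ hh),
        (attach_adj_castSucc _ _ _ _).1 hab⟩
  · obtain ⟨a, ha, b, hb, hbn, hab⟩ := h (B.map Fin.castSuccEmb)
      (hBA.trans (subset_insert _ _)) hne.map (by
        intro e
        exact hlast B (e ▸ mem_insert_self _ _))
    obtain ⟨a', ha', rfl⟩ := mem_map.1 ha
    rcases mem_insert.1 hb with rfl | hb
    · rw [Fin.coe_castSuccEmb, SimpleGraph.adj_comm, attach_adj_last] at hab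
      exact absurd (hab ▸ ha') hv
    · obtain ⟨b', hb', rfl⟩ := mem_map.1 hb
      exact ⟨a', ha', b', hb', fun hh => hbn (mem_map_of_mem _ hh),
        (attach_adj_castSucc _ _ _ _).1 hab⟩

lemma uncut_image {k n : ℕ} {H : SimpleGraph (Fin k)} (hH : H.Connected)
    {G : SimpleGraph (Fin n)} {φ : Fin k → Fin n} (hφ : ∀ a b, H.Adj a b → G.Adj (φ a) (φ b)) :
    Uncut G (univ.image φ) := by
  intro B hB hne hneq
  obtain ⟨x, hx⟩ := hne
  obtain ⟨x', -, rfl⟩ := mem_image.1 (hB hx)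
  obtain ⟨y', hy'⟩ : ∃ y', φ y' ∉ B := by
    by_contra! hcon
    apply hneq
    apply subset_antisymm hB
    intro z hz
    obtain ⟨z', -, rfl⟩ := mem_image.1 hz
    exact hcon z'
  obtain ⟨p⟩ := hH.preconnected x' y'
  obtain ⟨d, -, h1, h2⟩ := p.exists_boundary_dart (φ ⁻¹' (B : Set (Fin n))) hx hy'
  exact ⟨_, h1, _, mem_image_of_mem _ (mem_univ _), h2, hφ _ _ d.adj⟩

/-! ### Integer labelings of the vertices -/

/-- The labelings of `Fin n` by natural numbers with total weight `w`. -/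
def labelings (n w : ℕ) : Finset (Fin n → ℕ) := piAntidiag univ w

lemma mem_labelings {n w : ℕ} {m : Fin n → ℕ} : m ∈ labelings n w ↔ ∑ x, m x = w := by
  simp [labelings]

/-- The set of vertices carrying a nonzero label. -/
def labelSupp {n : ℕ} (m : Fin n → ℕ) : Finset (Fin n) := univ.filter fun x => m x ≠ 0

lemma mem_labelSupp {n : ℕ} {m : Fin n → ℕ} {x : Fin n} : x ∈ labelSupp m ↔ m x ≠ 0 := by
  simp [labelSupp]

lemma card_labelSupp_le {n w : ℕ} {m : Fin n → ℕ} (hm : m ∈ labelings n w) :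
    #(labelSupp m) ≤ w := by
  rw [mem_labelings] at hm
  rw [← hm, card_eq_sum_ones]
  calc ∑ x ∈ labelSupp m, 1 ≤ ∑ x ∈ labelSupp m, m x :=
        sum_le_sum fun x hx => Nat.one_le_iff_ne_zero.2 (mem_labelSupp.1 hx)
    _ ≤ ∑ x, m x := sum_le_sum_of_subset (subset_univ _)

/-- Extend a labeling to one further vertex, which receives the label `j`. -/
def extendLabel {n : ℕ} (m : Fin n → ℕ) (j : ℕ) : Fin (n + 1) → ℕ :=
  Fin.snoc (α := fun _ => ℕ) m j

@[simp] lemma extendLabel_castSucc {n : ℕ} (m : Fin n → ℕ) (j : ℕ) (x : Fin n) :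
    extendLabel m j x.castSucc = m x := by simp [extendLabel]

@[simp] lemma extendLabel_last {n : ℕ} (m : Fin n → ℕ) (j : ℕ) :
    extendLabel m j (Fin.last n) = j := by simp [extendLabel]

lemma sum_labelings_succ {n : ℕ} (w : ℕ) (f : (Fin (n + 1) → ℕ) → ℝ) :
    ∑ m ∈ labelings (n + 1) w, f m =
      ∑ j ∈ range (w + 1), ∑ m ∈ labelings n (w - j), f (extendLabel m j) := by
  rw [Finset.sum_sigma']
  refine Finset.sum_bij' (fun m _ => ⟨m (Fin.last n), fun x => m x.castSucc⟩)
    (fun p _ => extendLabel p.2 p.1) ?_ ?_ ?_ ?_ ?_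
  · intro m hm
    rw [mem_labelings, Fin.sum_univ_castSucc] at hm
    rw [mem_sigma, mem_range, mem_labelings]
    dsimp only
    omega
  · rintro ⟨j, m⟩ hm
    rw [mem_sigma, mem_range, mem_labelings] at hm
    rw [mem_labelings, Fin.sum_univ_castSucc]
    simp only [extendLabel_castSucc, extendLabel_last]
    dsimp only at hm
    omega
  · intro m _
    ext x
    refine Fin.lastCases ?_ (fun x => ?_) x <;> simp
  · rintro ⟨j, m⟩ _
    simp
  · intro m _
    congr 1
    ext x
    refine Fin.lastCases ?_ (fun x => ?_) x <;> simp

lemma labelSupp_extendLabel_zero {n : ℕ} (m : Fin n → ℕ) :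
    labelSupp (extendLabel m 0) = (labelSupp m).map Fin.castSuccEmb := by
  ext x
  refine Fin.lastCases ?_ (fun x => ?_) x
  · simp [mem_labelSupp]
  · simp [mem_labelSupp]

lemma labelSupp_extendLabel_pos {n : ℕ} (m : Fin n → ℕ) {j : ℕ} (hj : j ≠ 0) :
    labelSupp (extendLabel m j) = insert (Fin.last n) ((labelSupp m).map Fin.castSuccEmb) := by
  ext x
  refine Fin.lastCases ?_ (fun x => ?_) x
  · simp [mem_labelSupp, hj]
  · simp [mem_labelSupp, (Fin.castSucc_lt_last x).ne]

lemma card_labelSupp_extendLabel_pos {n : ℕ} (m : Fin n → ℕ) {j : ℕ} (hj : j ≠ 0) :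
    #(labelSupp (extendLabel m j)) = #(labelSupp m) + 1 := by
  rw [labelSupp_extendLabel_pos m hj, card_insert_of_notMem (by simp), card_map]

lemma labelSupp_add {n : ℕ} (m m' : Fin n → ℕ) :
    labelSupp (m + m') = labelSupp m ∪ labelSupp m' := by
  ext x
  simp only [mem_labelSupp, mem_union, Pi.add_apply]
  omega

lemma labelSupp_single {n : ℕ} (v : Fin n) : labelSupp (Pi.single v 1) = {v} := by
  ext x
  by_cases h : x = v <;> simp [mem_labelSupp, h]

lemma labelSupp_add_single_of_mem {n : ℕ} {m : Fin n → ℕ} {v : Fin n} (hv : v ∈ labelSupp m) :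
    labelSupp (m + Pi.single v 1) = labelSupp m := by
  rw [labelSupp_add, labelSupp_single]
  exact union_eq_left.2 (singleton_subset_iff.2 hv)

lemma add_mem_labelings {n w w' : ℕ} {m m' : Fin n → ℕ} (hm : m ∈ labelings n w)
    (hm' : m' ∈ labelings n w') : m + m' ∈ labelings n (w + w') := by
  rw [mem_labelings] at *
  simp [sum_add_distrib, hm, hm']

lemma single_mem_labelings {n : ℕ} (v : Fin n) : Pi.single v 1 ∈ labelings n 1 := by
  rw [mem_labelings]
  simp

lemma sum_add_single_le {n : ℕ} (w : ℕ) {F : (Fin n → ℕ) → ℝ} (hF : ∀ m, 0 ≤ F m) :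
    ∑ v, ∑ m ∈ labelings n w, F (m + Pi.single v 1) ≤
      (w + 1 : ℕ) * ∑ m ∈ labelings n (w + 1), F m := by
  calc ∑ v, ∑ m ∈ labelings n w, F (m + Pi.single v 1)
      ≤ ∑ v, ∑ m ∈ labelings n (w + 1), if v ∈ labelSupp m then F m else 0 := by
        refine sum_le_sum fun v _ => ?_
        rw [← sum_filter, ← sum_image (g := fun m => m + Pi.single v 1) (f := F)
          (fun a _ b _ h => add_right_cancel h)]
        refine sum_le_sum_of_subset_of_nonneg ?_ fun m _ _ => hF m
        intro m' hm'
        obtain ⟨m, hm, rfl⟩ := mem_image.1 hm'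
        exact mem_filter.2 ⟨add_mem_labelings hm (single_mem_labelings v), by
          simp [mem_labelSupp]⟩
    _ = ∑ m ∈ labelings n (w + 1), #(labelSupp m) * F m := by
        rw [sum_comm]
        refine sum_congr rfl fun m _ => ?_
        rw [← sum_filter, sum_const, nsmul_eq_mul]
        simp
    _ ≤ _ := by
        rw [mul_sum]
        refine sum_le_sum fun m hm => ?_
        have := card_labelSupp_le hm
        have := hF m
        gcongr

lemma card_Iic_le {n w : ℕ} {m : Fin n → ℕ} (hm : m ∈ labelings n w) :
    #(Iic m) ≤ 2 ^ w := by
  rw [mem_labelings] at hm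
  rw [Pi.card_Iic, ← hm, ← prod_pow_eq_pow_sum]
  refine prod_le_prod' fun x _ => ?_
  rw [Nat.card_Iic]
  exact Nat.lt_two_pow_self

lemma sum_sum_add_le {n : ℕ} (w w' : ℕ) {F : (Fin n → ℕ) → ℝ} (hF : ∀ m, 0 ≤ F m) :
    ∑ m ∈ labelings n w, ∑ m' ∈ labelings n w', F (m + m') ≤
      (2 ^ (w + w') : ℕ) * ∑ m ∈ labelings n (w + w'), F m := by
  calc ∑ m ∈ labelings n w, ∑ m' ∈ labelings n w', F (m + m')
      ≤ ∑ m ∈ labelings n w, ∑ m' ∈ labelings n (w + w'), if m ≤ m' then F m' else 0 := by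
        refine sum_le_sum fun m hm => ?_
        rw [← sum_filter, ← sum_image (g := fun m' => m + m') (f := F)
          (fun a _ b _ h => add_left_cancel h)]
        refine sum_le_sum_of_subset_of_nonneg ?_ fun m _ _ => hF m
        intro m₁ hm₁
        obtain ⟨m', hm', rfl⟩ := mem_image.1 hm₁
        exact mem_filter.2 ⟨add_mem_labelings hm hm', le_self_add⟩
    _ = ∑ m' ∈ labelings n (w + w'), #((labelings n w).filter (· ≤ m')) * F m' := by
        rw [sum_comm]
        refine sum_congr rfl fun m _ => ?_
        rw [← sum_filter, sum_const, nsmul_eq_mul]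
    _ ≤ _ := by
        rw [mul_sum]
        refine sum_le_sum fun m hm => mul_le_mul_of_nonneg_right ?_ (hF m)
        refine Nat.cast_le.2 (le_trans (card_le_card ?_) (card_Iic_le hm))
        intro m' hm'
        exact mem_Iic.2 (mem_filter.1 hm').2

lemma sum_sum_add_add_le {n : ℕ} (w w' : ℕ) {F : (Fin n → ℕ) → ℝ} (hF : ∀ m, 0 ≤ F m)
    (a : Fin n → ℕ) :
    ∑ m ∈ labelings n w, ∑ m' ∈ labelings n w', F (m + m' + a) ≤
      (2 ^ (w + w') : ℕ) * ∑ m ∈ labelings n (w + w'), F (m + a) :=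
  sum_sum_add_le w w' (F := fun m => F (m + a)) fun _ => hF _

/-! ### Rising factorial moments -/

/-- The product over the vertices of the rising factorial powers of the degrees. -/
def risingProd {n : ℕ} (G : SimpleGraph (Fin n)) (m : Fin n → ℕ) : ℝ :=
  ∏ x, ((deg G x).ascFactorial (m x) : ℝ)

lemma risingProd_nonneg {n : ℕ} (G : SimpleGraph (Fin n)) (m : Fin n → ℕ) :
    0 ≤ risingProd G m := prod_nonneg fun _ _ => Nat.cast_nonneg _

lemma risingProd_mul_le {n : ℕ} (G : SimpleGraph (Fin n)) (m m' : Fin n → ℕ) :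
    risingProd G m * risingProd G m' ≤ risingProd G (m + m') := by
  rw [risingProd, risingProd, risingProd, ← prod_mul_distrib]
  refine prod_le_prod (fun _ _ => by positivity) fun x _ => ?_
  exact_mod_cast ascFactorial_mul_le _ _ _

lemma deg_mul_risingProd_le {n : ℕ} (G : SimpleGraph (Fin n)) (m : Fin n → ℕ) (v : Fin n) :
    (deg G v : ℝ) * risingProd G m ≤ risingProd G (m + Pi.single v 1) := by
  have h : risingProd G (Pi.single v 1) = deg G v := by
    rw [risingProd, prod_eq_single v]
    · simp [Nat.ascFactorial_succ]
    · intro x _ hx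
      simp [hx]
    · simp
  rw [← h, mul_comm]
  exact risingProd_mul_le _ _ _

lemma risingProd_attach_extendLabel {n : ℕ} (G : SimpleGraph (Fin n)) (v : Fin n)
    (m : Fin n → ℕ) (j : ℕ) :
    risingProd (attach G v) (extendLabel m j) =
      j.factorial * ∏ x, ((deg G x + if x = v then 1 else 0).ascFactorial (m x) : ℝ) := by
  rw [risingProd, Fin.prod_univ_castSucc]
  simp only [deg_attach_castSucc, deg_attach_last, extendLabel_castSucc, extendLabel_last,
    Nat.one_ascFactorial]
  rw [mul_comm]

lemma prod_erase_ite {n : ℕ} (G : SimpleGraph (Fin n)) (v : Fin n) (f : ℕ → Fin n → ℝ) :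
    ∏ x ∈ univ.erase v, f (deg G x + if x = v then 1 else 0) x =
      ∏ x ∈ univ.erase v, f (deg G x) x :=
  prod_congr rfl fun x hx => by rw [if_neg (ne_of_mem_erase hx), add_zero]

lemma deg_mul_prod_shift {n : ℕ} (G : SimpleGraph (Fin n)) (v : Fin n) (m : Fin n → ℕ) :
    (deg G v : ℝ) * ∏ x, ((deg G x + if x = v then 1 else 0).ascFactorial (m x) : ℝ) =
      risingProd G m * (deg G v + m v : ℕ) := by
  rw [risingProd, ← mul_prod_erase univ _ (mem_univ v), ← mul_prod_erase univ _ (mem_univ v),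
    prod_erase_ite G v fun d x => (d.ascFactorial (m x) : ℝ), if_pos rfl, ← mul_assoc,
    ← Nat.cast_mul, mul_ascFactorial_add_indicator, Nat.cast_mul]
  ring

lemma risingProd_mul_deg_add {n : ℕ} (G : SimpleGraph (Fin n)) (v : Fin n) (m : Fin n → ℕ) :
    risingProd G m * (deg G v + m v : ℕ) = risingProd G (m + Pi.single v 1) := by
  rw [risingProd, risingProd, ← mul_prod_erase univ _ (mem_univ v)]
  conv_rhs => rw [← mul_prod_erase univ _ (mem_univ v)]
  have h : ∏ x ∈ univ.erase v,
      ((deg G x).ascFactorial ((m + Pi.single v 1 : Fin n → ℕ) x) : ℝ) =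
      ∏ x ∈ univ.erase v, ((deg G x).ascFactorial (m x) : ℝ) :=
    prod_congr rfl fun x hx => by simp [ne_of_mem_erase hx]
  rw [h, Pi.add_apply, Pi.single_eq_same, Nat.ascFactorial_succ, Nat.cast_mul]
  ring

/-- The contribution of a labeling with support of size `i` to the moment of order `i`. -/
def momentTerm {n : ℕ} (G : SimpleGraph (Fin n)) (i : ℕ) (m : Fin n → ℕ) : ℝ :=
  if #(labelSupp m) = i ∧ Uncut G (labelSupp m) then risingProd G m else 0

/-- The sum of rising factorial products over all labelings of weight `w` whose support is
a connected set of `i` vertices. -/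
def moment {n : ℕ} (G : SimpleGraph (Fin n)) (w i : ℕ) : ℝ :=
  ∑ m ∈ labelings n w, momentTerm G i m

lemma momentTerm_nonneg {n : ℕ} (G : SimpleGraph (Fin n)) (i : ℕ) (m : Fin n → ℕ) :
    0 ≤ momentTerm G i m := by
  rw [momentTerm]
  split_ifs
  exacts [risingProd_nonneg _ _, le_rfl]

lemma moment_nonneg {n : ℕ} (G : SimpleGraph (Fin n)) (w i : ℕ) : 0 ≤ moment G w i :=
  sum_nonneg fun _ _ => momentTerm_nonneg _ _ _

lemma moment_zero_right {n : ℕ} (G : SimpleGraph (Fin n)) {w : ℕ} (hw : w ≠ 0) :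
    moment G w 0 = 0 := by
  refine sum_eq_zero fun m hm => ?_
  rw [momentTerm, if_neg]
  rintro ⟨h, -⟩
  rw [mem_labelings] at hm
  apply hw
  rw [← hm]
  refine sum_eq_zero fun x _ => ?_
  by_contra hx
  exact (notMem_empty x) (card_eq_zero.1 h ▸ mem_labelSupp.2 hx)

lemma deg_mul_momentTerm_attach_zero_le {n : ℕ} (G : SimpleGraph (Fin n)) (v : Fin n) (i : ℕ)
    (m : Fin n → ℕ) :
    (deg G v : ℝ) * momentTerm (attach G v) i (extendLabel m 0) ≤
      momentTerm G i m * (deg G v + m v : ℕ) := by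
  by_cases h : #(labelSupp (extendLabel m 0)) = i ∧
      Uncut (attach G v) (labelSupp (extendLabel m 0))
  · have h' := h
    rw [labelSupp_extendLabel_zero, card_map] at h'
    rw [momentTerm, if_pos h, momentTerm, if_pos ⟨h'.1, uncut_of_attach h'.2⟩,
      risingProd_attach_extendLabel, Nat.factorial_zero, Nat.cast_one, one_mul,
      deg_mul_prod_shift]
  · rw [momentTerm, if_neg h, mul_zero]
    exact mul_nonneg (momentTerm_nonneg _ _ _) (Nat.cast_nonneg _)

lemma deg_mul_momentTerm_attach_pos_le {n : ℕ} (G : SimpleGraph (Fin n)) (v : Fin n) (i : ℕ)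
    {m : Fin n → ℕ} (hm : (labelSupp m).Nonempty) {j : ℕ} (hj : j ≠ 0) :
    (deg G v : ℝ) * momentTerm (attach G v) (i + 1) (extendLabel m j) ≤
      j.factorial * momentTerm G i (m + Pi.single v 1) := by
  by_cases h : #(labelSupp (extendLabel m j)) = i + 1 ∧
      Uncut (attach G v) (labelSupp (extendLabel m j))
  · have h' := h
    rw [card_labelSupp_extendLabel_pos m hj, labelSupp_extendLabel_pos m hj,
      Nat.add_right_cancel_iff] at h'
    have hv := mem_of_uncut_attach hm h'.2
    rw [momentTerm, if_pos h, momentTerm, labelSupp_add_single_of_mem hv,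
      if_pos ⟨h'.1, uncut_of_attach_insert h'.2⟩, risingProd_attach_extendLabel, mul_left_comm,
      deg_mul_prod_shift, risingProd_mul_deg_add]
  · rw [momentTerm, if_neg h, mul_zero]
    exact mul_nonneg (Nat.cast_nonneg _) (momentTerm_nonneg _ _ _)

lemma momentTerm_attach_extendLabel_le {n : ℕ} (G : SimpleGraph (Fin n)) (v : Fin n) (i : ℕ)
    {m : Fin n → ℕ} (hm : m ∈ labelings n 0) (j : ℕ) :
    momentTerm (attach G v) i (extendLabel m j) ≤ j.factorial := by
  rw [momentTerm]
  split_ifs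
  · rw [mem_labelings, sum_eq_zero_iff] at hm
    rw [risingProd_attach_extendLabel]
    simp [hm]
  · exact Nat.cast_nonneg _

lemma sum_deg_mul_moment_attach_le {n : ℕ} (G : SimpleGraph (Fin n)) {w : ℕ} (hw : w ≠ 0)
    (i : ℕ) :
    ∑ v, (deg G v : ℝ) * moment (attach G v) w (i + 1) ≤
      ((∑ v, deg G v : ℕ) + w) * moment G w (i + 1) + (∑ v, deg G v : ℕ) * w.factorial +
        w.factorial * w * ∑ j ∈ Ico 1 w, moment G (w - j + 1) i := by
  have hsplit : ∀ f : ℕ → ℝ, ∑ j ∈ range (w + 1), f j = f 0 + f w + ∑ j ∈ Ico 1 w, f j := by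
    intro f
    rw [sum_range_succ, range_eq_Ico, sum_eq_sum_Ico_succ_bot (Nat.pos_of_ne_zero hw)]
    ring
  have hzero : ∑ v, (deg G v : ℝ) * ∑ m ∈ labelings n (w - 0),
      momentTerm (attach G v) (i + 1) (extendLabel m 0) ≤
      ((∑ v, deg G v : ℕ) + w) * moment G w (i + 1) := by
    calc _ ≤ ∑ v, ∑ m ∈ labelings n w, momentTerm G (i + 1) m * (deg G v + m v : ℕ) := by
          refine sum_le_sum fun v _ => ?_
          rw [mul_sum, Nat.sub_zero]
          exact sum_le_sum fun m _ => deg_mul_momentTerm_attach_zero_le _ _ _ _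
      _ = _ := by
          rw [sum_comm, moment, mul_sum]
          refine sum_congr rfl fun m hm => ?_
          rw [mem_labelings] at hm
          rw [← mul_sum, ← Nat.cast_sum, sum_add_distrib, hm]
          push_cast
          ring
  have hlast : ∑ v, (deg G v : ℝ) * ∑ m ∈ labelings n (w - w),
      momentTerm (attach G v) (i + 1) (extendLabel m w) ≤
      (∑ v, deg G v : ℕ) * w.factorial := by
    rw [Nat.cast_sum, sum_mul]
    refine sum_le_sum fun v _ => mul_le_mul_of_nonneg_left ?_ (Nat.cast_nonneg _)
    rw [Nat.sub_self]
    have hc : #(labelings n 0) = 1 := by simp [labelings]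
    calc _ ≤ ∑ m ∈ labelings n 0, (w.factorial : ℝ) :=
          sum_le_sum fun m hm => momentTerm_attach_extendLabel_le _ _ _ hm _
      _ = _ := by simp [hc]
  have hmid : ∀ j ∈ Ico 1 w, ∑ v, (deg G v : ℝ) * ∑ m ∈ labelings n (w - j),
      momentTerm (attach G v) (i + 1) (extendLabel m j) ≤
      w.factorial * w * moment G (w - j + 1) i := by
    intro j hj
    rw [mem_Ico] at hj
    calc _ ≤ ∑ v, ∑ m ∈ labelings n (w - j),
          (w.factorial : ℝ) * momentTerm G i (m + Pi.single v 1) := by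
          refine sum_le_sum fun v _ => ?_
          rw [mul_sum]
          refine sum_le_sum fun m hm => ?_
          have hne : (labelSupp m).Nonempty := by
            rw [mem_labelings] at hm
            obtain ⟨x, -, hx⟩ := exists_ne_zero_of_sum_ne_zero (s := univ) (f := m) (by omega)
            exact ⟨x, mem_labelSupp.2 hx⟩
          refine (deg_mul_momentTerm_attach_pos_le G v i hne (by omega)).trans ?_
          refine mul_le_mul_of_nonneg_right ?_ (momentTerm_nonneg _ _ _)
          exact_mod_cast Nat.factorial_le hj.2.le
      _ = w.factorial * ∑ v, ∑ m ∈ labelings n (w - j),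
          momentTerm G i (m + Pi.single v 1) := by simp only [mul_sum]
      _ ≤ w.factorial * ((w - j + 1 : ℕ) * moment G (w - j + 1) i) := by
          gcongr
          exact sum_add_single_le _ fun m => momentTerm_nonneg _ _ _
      _ ≤ _ := by
          rw [mul_assoc]
          have := moment_nonneg G (w - j + 1) i
          gcongr
          omega
  calc _ = ∑ v, ((deg G v : ℝ) * ∑ m ∈ labelings n (w - 0),
          momentTerm (attach G v) (i + 1) (extendLabel m 0) +
        (deg G v : ℝ) * ∑ m ∈ labelings n (w - w),
          momentTerm (attach G v) (i + 1) (extendLabel m w) +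
        ∑ j ∈ Ico 1 w, (deg G v : ℝ) * ∑ m ∈ labelings n (w - j),
          momentTerm (attach G v) (i + 1) (extendLabel m j)) := by
        refine sum_congr rfl fun v _ => ?_
        rw [moment, sum_labelings_succ, hsplit, mul_add, mul_add, mul_sum (Ico 1 w)]
    _ ≤ _ := by
        rw [sum_add_distrib, sum_add_distrib, sum_comm, mul_sum]
        exact add_le_add (add_le_add hzero hlast) (sum_le_sum hmid)

/-! ### Expectations under the preferential attachment law -/

/-- The expectation of `f` after `k` steps started from `S`. -/
def expect {n₀ : ℕ} (S : SimpleGraph (Fin n₀)) (k : ℕ) (f : SimpleGraph (Fin (n₀ + k)) → ℝ) : ℝ :=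
  ∑ G, law S k G * f G

lemma expect_succ {n₀ : ℕ} (S : SimpleGraph (Fin n₀)) (k : ℕ)
    (f : SimpleGraph (Fin (n₀ + (k + 1))) → ℝ) :
    expect S (k + 1) f = expect S k fun H =>
      ∑ v, (deg H v : ℝ) / (2 * (n₀ + k : ℕ) - 2) * f (attach H v) := by
  simp only [expect, law, sum_mul]
  rw [sum_comm]
  refine sum_congr rfl fun H _ => ?_
  rw [sum_comm, mul_sum]
  refine sum_congr rfl fun v _ => ?_
  refine (sum_eq_single (M := ℝ) (attach H v : SimpleGraph (Fin (n₀ + (k + 1)))) ?_ ?_).trans ?_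
  · intro G _ hG
    simp [Ne.symm hG]
  · simp
  · simp [mul_assoc]

lemma law_nonneg {n₀ : ℕ} (hn₀ : 2 ≤ n₀) (S : SimpleGraph (Fin n₀)) (k : ℕ)
    (G : SimpleGraph (Fin (n₀ + k))) : 0 ≤ law S k G := by
  induction k with
  | zero =>
    simp only [law]
    split_ifs <;> simp
  | succ k ih =>
    simp only [law]
    refine sum_nonneg fun H _ => sum_nonneg fun v _ => ?_
    have h1 : (1 : ℝ) ≤ (n₀ + k : ℕ) := by
      exact_mod_cast (by omega : 1 ≤ n₀ + k)
    have h2 : (0 : ℝ) ≤ 2 * (n₀ + k : ℕ) - 2 := by linarith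
    have := ih H
    split_ifs <;> positivity

lemma sum_deg_of_law_ne_zero {n₀ : ℕ} {S : SimpleGraph (Fin n₀)} (hS : S.IsTree) {k : ℕ}
    {G : SimpleGraph (Fin (n₀ + k))} (hG : law S k G ≠ 0) :
    ∑ x, deg G x + 2 = 2 * (n₀ + k) := by
  induction k with
  | zero =>
    have : G = S := by
      by_contra h
      exact hG (by simp only [law]; rw [if_neg h])
    subst this
    exact sum_deg_of_isTree hS
  | succ k ih =>
    simp only [law] at hG
    obtain ⟨H, -, hH⟩ := exists_ne_zero_of_sum_ne_zero hG
    obtain ⟨v, -, hv⟩ := exists_ne_zero_of_sum_ne_zero hH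
    have h1 : attach H v = G := by
      by_contra h
      simp [h] at hv
    have h2 := ih (left_ne_zero_of_mul (left_ne_zero_of_mul hv))
    subst h1
    change ∑ x : Fin (n₀ + k + 1), deg (attach H v) x + 2 = _
    rw [sum_deg_attach]
    omega

lemma expect_mono {n₀ : ℕ} (hn₀ : 2 ≤ n₀) {S : SimpleGraph (Fin n₀)} (hS : S.IsTree) (k : ℕ)
    {f g : SimpleGraph (Fin (n₀ + k)) → ℝ}
    (hfg : ∀ G, ∑ x, deg G x + 2 = 2 * (n₀ + k) → f G ≤ g G) : expect S k f ≤ expect S k g := by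
  refine sum_le_sum fun G _ => ?_
  by_cases hG : law S k G = 0
  · simp [hG]
  · exact mul_le_mul_of_nonneg_left (hfg G (sum_deg_of_law_ne_zero hS hG)) (law_nonneg hn₀ S k G)

lemma expect_const {n₀ : ℕ} (hn₀ : 2 ≤ n₀) {S : SimpleGraph (Fin n₀)} (hS : S.IsTree) (k : ℕ)
    (c : ℝ) : expect S k (fun _ => c) = c := by
  induction k with
  | zero => simp [expect, law]
  | succ k ih =>
    have h : ∀ f g : SimpleGraph (Fin (n₀ + k)) → ℝ,
        (∀ G, ∑ x, deg G x + 2 = 2 * (n₀ + k) → f G = g G) → expect S k f = expect S k g :=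
      fun f g hfg => le_antisymm (expect_mono hn₀ hS k fun G hG => (hfg G hG).le)
        (expect_mono hn₀ hS k fun G hG => (hfg G hG).ge)
    rw [expect_succ, h _ (fun _ => c), ih]
    intro G hG
    have h1 : ((∑ x, deg G x : ℕ) : ℝ) = 2 * (n₀ + k : ℕ) - 2 := by
      rw [eq_sub_iff_add_eq]
      exact_mod_cast hG
    have h2 : (2 : ℝ) ≤ (n₀ + k : ℕ) := by exact_mod_cast (by omega : 2 ≤ n₀ + k)
    rw [← sum_mul, ← sum_div, ← Nat.cast_sum, h1, div_self (by linarith), one_mul]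

lemma expect_nonneg {n₀ : ℕ} (hn₀ : 2 ≤ n₀) (S : SimpleGraph (Fin n₀)) (k : ℕ)
    {f : SimpleGraph (Fin (n₀ + k)) → ℝ} (hf : ∀ G, 0 ≤ f G) : 0 ≤ expect S k f :=
  sum_nonneg fun G _ => mul_nonneg (law_nonneg hn₀ S k G) (hf G)

lemma expect_add {n₀ : ℕ} (S : SimpleGraph (Fin n₀)) (k : ℕ)
    (f g : SimpleGraph (Fin (n₀ + k)) → ℝ) :
    expect S k (fun G => f G + g G) = expect S k f + expect S k g := by
  simp only [expect, mul_add, sum_add_distrib]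

lemma expect_const_mul {n₀ : ℕ} (S : SimpleGraph (Fin n₀)) (k : ℕ) (c : ℝ)
    (f : SimpleGraph (Fin (n₀ + k)) → ℝ) :
    expect S k (fun G => c * f G) = c * expect S k f := by
  simp only [expect, mul_sum, mul_left_comm]

lemma expect_sum {n₀ : ℕ} (S : SimpleGraph (Fin n₀)) (k : ℕ) {ι : Type*} (s : Finset ι)
    (f : ι → SimpleGraph (Fin (n₀ + k)) → ℝ) :
    expect S k (fun G => ∑ i ∈ s, f i G) = ∑ i ∈ s, expect S k (f i) := by
  simp only [expect, mul_sum]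
  rw [sum_comm]

lemma expect_moment_succ_le {n₀ : ℕ} (hn₀ : 2 ≤ n₀) {S : SimpleGraph (Fin n₀)} (hS : S.IsTree)
    {w : ℕ} (hw : w ≠ 0) (i k : ℕ) :
    expect S (k + 1) (fun G => moment G w (i + 1)) ≤
      (1 + (w : ℝ) / 2 / (n₀ - 1 + k : ℕ)) * expect S k (fun G => moment G w (i + 1)) +
        w.factorial + w.factorial * w / (n₀ - 1 + k : ℕ) *
          ∑ j ∈ Ico 1 w, expect S k fun G => moment G (w - j + 1) i := by
  set N : ℝ := ((n₀ - 1 + k : ℕ) : ℝ) with hN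
  have hN0 : 0 < N := by
    rw [hN]
    exact_mod_cast (by omega : 0 < n₀ - 1 + k)
  have hN2 : (2 : ℝ) * (n₀ + k : ℕ) - 2 = 2 * N := by
    have : n₀ + k = (n₀ - 1 + k) + 1 := by omega
    rw [this, hN]
    push_cast
    ring
  have hrhs : expect S k (fun G => (1 + (w : ℝ) / 2 / N) * moment G w (i + 1) + w.factorial +
      w.factorial * w / N * ∑ j ∈ Ico 1 w, moment G (w - j + 1) i) =
      (1 + (w : ℝ) / 2 / N) * expect S k (fun G => moment G w (i + 1)) + w.factorial +
        w.factorial * w / N * ∑ j ∈ Ico 1 w, expect S k fun G => moment G (w - j + 1) i := by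
    rw [expect_add, expect_add, expect_const hn₀ hS, expect_const_mul, expect_const_mul,
      expect_sum]
  rw [expect_succ, hN2, ← hrhs]
  refine expect_mono hn₀ hS k fun G hG => ?_
  have hdeg : ((∑ x, deg G x : ℕ) : ℝ) = 2 * N := by
    rw [← hN2, eq_sub_iff_add_eq]
    exact_mod_cast hG
  have h := sum_deg_mul_moment_attach_le G hw i
  rw [hdeg] at h
  have hM : 0 ≤ ∑ j ∈ Ico 1 w, moment G (w - j + 1) i := sum_nonneg fun _ _ => moment_nonneg _ _ _
  calc _ = (∑ v, (deg G v : ℝ) * moment (attach G v) w (i + 1)) / (2 * N) := by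
        rw [sum_div]
        exact sum_congr rfl fun v _ => by ring
    _ ≤ ((2 * N + w) * moment G w (i + 1) + 2 * N * w.factorial +
        w.factorial * w * ∑ j ∈ Ico 1 w, moment G (w - j + 1) i) / (2 * N) := by gcongr
    _ = (1 + (w : ℝ) / 2 / N) * moment G w (i + 1) + w.factorial +
        w.factorial * w / N * (∑ j ∈ Ico 1 w, moment G (w - j + 1) i) / 2 := by
        field_simp
    _ ≤ _ := by
        have : 0 ≤ w.factorial * w / N * (∑ j ∈ Ico 1 w, moment G (w - j + 1) i) := by positivity
        linarith

/-! ### Growth of solutions of the moment recursion -/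

/-- One plus the `N`-th harmonic number. -/
def harmonicSucc (N : ℕ) : ℝ := 1 + ∑ i ∈ range N, ((i : ℝ) + 1)⁻¹

lemma one_le_harmonicSucc (N : ℕ) : 1 ≤ harmonicSucc N := by
  rw [harmonicSucc, le_add_iff_nonneg_right]
  positivity

lemma harmonicSucc_le (N : ℕ) : harmonicSucc N ≤ 2 + Real.log N := by
  have h := harmonic_le_one_add_log N
  rw [harmonic] at h
  push_cast at h
  rw [harmonicSucc]
  linarith

lemma harmonicSucc_pow_succ_le {N : ℕ} (hN : 0 < N) (j : ℕ) :
    harmonicSucc N ^ (j + 1) + harmonicSucc N ^ j / (2 * N) ≤ harmonicSucc (N + 1) ^ (j + 1) := by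
  have hN' : (1 : ℝ) ≤ N := by exact_mod_cast hN
  have h1 := one_le_harmonicSucc N
  have h2 : harmonicSucc N + 1 / (2 * N) ≤ harmonicSucc (N + 1) := by
    rw [harmonicSucc, harmonicSucc, sum_range_succ, ← add_assoc, ← one_div]
    gcongr
    linarith
  have h3 : harmonicSucc N ^ j ≤ harmonicSucc (N + 1) ^ j := by
    refine pow_le_pow_left₀ (by linarith) (le_trans ?_ h2) j
    have : (0 : ℝ) ≤ 1 / (2 * N) := by positivity
    linarith
  have h4 : 0 ≤ harmonicSucc (N + 1) ^ j :=
    pow_nonneg (zero_le_one.trans (one_le_harmonicSucc _)) _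
  calc _ = harmonicSucc N ^ j * (harmonicSucc N + 1 / (2 * N)) := by ring
    _ ≤ harmonicSucc (N + 1) ^ j * harmonicSucc (N + 1) := by gcongr
    _ = _ := by ring

lemma growth_bound {N₀ : ℕ} (hN₀ : 0 < N₀) {p B : ℝ} (hp : 1 ≤ p) (hB : 0 ≤ B) (j : ℕ)
    {a : ℕ → ℝ}
    (ha : ∀ k, a (k + 1) ≤ (1 + p / (N₀ + k : ℕ)) * a k +
      B / (N₀ + k : ℕ) * ((N₀ + k : ℕ) : ℝ) ^ p * harmonicSucc (N₀ + k) ^ j) :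
    ∃ C, 0 ≤ C ∧ ∀ k, a k ≤ C * ((N₀ + k : ℕ) : ℝ) ^ p * harmonicSucc (N₀ + k) ^ (j + 1) := by
  refine ⟨|a 0| + 2 * B, by positivity, fun k => ?_⟩
  set C := |a 0| + 2 * B with hC
  have hC0 : 0 ≤ C := by positivity
  induction k with
  | zero =>
    have h1 : (1 : ℝ) ≤ ((N₀ + 0 : ℕ) : ℝ) ^ p := by
      refine Real.one_le_rpow ?_ (by linarith)
      exact_mod_cast hN₀
    have h2 : 1 ≤ harmonicSucc (N₀ + 0) ^ (j + 1) := one_le_pow₀ (one_le_harmonicSucc _)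
    calc a 0 ≤ C * 1 * 1 := by
          have := le_abs_self (a 0)
          rw [hC]
          linarith
      _ ≤ _ := by gcongr
  | succ k ih =>
    have hk := ha k
    rw [← add_assoc]
    have hN : 0 < N₀ + k := by omega
    generalize N₀ + k = N at ih hk hN
    have hN' : (0 : ℝ) < N := by exact_mod_cast hN
    have hL := one_le_harmonicSucc N
    have hL' := one_le_harmonicSucc (N + 1)
    have hpow : (1 + p / N) * (N : ℝ) ^ p ≤ ((N + 1 : ℕ) : ℝ) ^ p := by
      have h1 : 1 + p * (1 / N) ≤ (1 + 1 / (N : ℝ)) ^ p :=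
        one_add_mul_self_le_rpow_one_add (by linarith [one_div_pos.2 hN']) hp
      have h2 : ((N + 1 : ℕ) : ℝ) = (1 + 1 / (N : ℝ)) * N := by
        push_cast
        field_simp
      rw [h2, Real.mul_rpow (by positivity) hN'.le, ← mul_one_div p]
      gcongr
    have hmono : (N : ℝ) ^ p ≤ ((N + 1 : ℕ) : ℝ) ^ p := by
      refine Real.rpow_le_rpow hN'.le ?_ (by linarith)
      push_cast
      linarith
    have hNp : 0 ≤ (N : ℝ) ^ p := by positivity
    have hpN : 0 ≤ p / N := by positivity
    have hBC : B ≤ C / 2 := by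
      have := abs_nonneg (a 0)
      linarith
    have hLj : 0 ≤ harmonicSucc N ^ j := by positivity
    have hLj' : 0 ≤ harmonicSucc N ^ (j + 1) := by positivity
    calc a (k + 1) ≤ (1 + p / N) * (C * (N : ℝ) ^ p * harmonicSucc N ^ (j + 1)) +
          B / N * (N : ℝ) ^ p * harmonicSucc N ^ j := by
          refine hk.trans ?_
          gcongr
      _ = C * harmonicSucc N ^ (j + 1) * ((1 + p / N) * (N : ℝ) ^ p) +
          B / N * harmonicSucc N ^ j * (N : ℝ) ^ p := by ring
      _ ≤ C * harmonicSucc N ^ (j + 1) * ((N + 1 : ℕ) : ℝ) ^ p +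
          C / 2 / N * harmonicSucc N ^ j * ((N + 1 : ℕ) : ℝ) ^ p := by gcongr
      _ = C * ((N + 1 : ℕ) : ℝ) ^ p *
          (harmonicSucc N ^ (j + 1) + harmonicSucc N ^ j / (2 * N)) := by
          field_simp
      _ ≤ _ := by
          gcongr
          exact harmonicSucc_pow_succ_le hN j

lemma expect_moment_le {n₀ : ℕ} (hn₀ : 2 ≤ n₀) {S : SimpleGraph (Fin n₀)} (hS : S.IsTree)
    (i : ℕ) : ∀ w, 2 ≤ w → ∃ C, 0 ≤ C ∧ ∀ k, expect S k (fun G => moment G w i) ≤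
      C * ((n₀ - 1 + k : ℕ) : ℝ) ^ ((w : ℝ) / 2) * harmonicSucc (n₀ - 1 + k) ^ i := by
  induction i with
  | zero =>
    intro w hw
    refine ⟨0, le_rfl, fun k => ?_⟩
    simp only [moment_zero_right _ (by omega : w ≠ 0), expect, mul_zero, sum_const_zero, zero_mul,
      le_refl]
  | succ i ih =>
    intro w hw
    choose C hC0 hC using ih
    have hp : 1 ≤ (w : ℝ) / 2 := by
      rw [le_div_iff₀ two_pos, one_mul]
      exact_mod_cast hw
    set D : ℝ := ∑ j ∈ (Ico 1 w).attach, C (w - j + 1) (by have := mem_Ico.1 j.2; omega) with hD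
    have hD0 : 0 ≤ D := sum_nonneg fun j _ => hC0 _ _
    refine growth_bound (N₀ := n₀ - 1) (by omega) hp
      (B := w.factorial + w.factorial * w * D) (by positivity) i fun k => ?_
    refine (expect_moment_succ_le hn₀ hS (by omega) i k).trans ?_
    have hN : 0 < n₀ - 1 + k := by omega
    have hsum : ∑ j ∈ Ico 1 w, expect S k (fun G => moment G (w - j + 1) i) ≤
        D * ((n₀ - 1 + k : ℕ) : ℝ) ^ ((w : ℝ) / 2) * harmonicSucc (n₀ - 1 + k) ^ i := by
      rw [← sum_attach, hD, sum_mul, sum_mul]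
      refine sum_le_sum fun j _ => ?_
      have hj := mem_Ico.1 j.2
      have h2 : 2 ≤ w - j + 1 := by omega
      refine (hC (w - j + 1) h2 k).trans ?_
      have h1 : (1 : ℝ) ≤ (n₀ - 1 + k : ℕ) := by exact_mod_cast hN
      have h3 := hC0 _ h2
      have hL := one_le_harmonicSucc (n₀ - 1 + k)
      gcongr
      omega
    generalize n₀ - 1 + k = N at hN hsum ⊢
    have hN' : (1 : ℝ) ≤ N := by exact_mod_cast hN
    have hL : 1 ≤ harmonicSucc N ^ i := one_le_pow₀ (one_le_harmonicSucc N)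
    have hfac : (w.factorial : ℝ) ≤
        w.factorial / N * (N : ℝ) ^ ((w : ℝ) / 2) * harmonicSucc N ^ i := by
      calc (w.factorial : ℝ) = w.factorial / N * (N : ℝ) ^ (1 : ℝ) * 1 := by
            rw [Real.rpow_one]
            field_simp
        _ ≤ _ := by gcongr
    calc _ ≤ (1 + (w : ℝ) / 2 / N) * expect S k (fun G => moment G w (i + 1)) +
          w.factorial / N * (N : ℝ) ^ ((w : ℝ) / 2) * harmonicSucc N ^ i +
          w.factorial * w / N * (D * (N : ℝ) ^ ((w : ℝ) / 2) * harmonicSucc N ^ i) := by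
          gcongr
      _ = _ := by ring

/-! ### Expansion of the observable over labelings -/

/-- The labeling of the vertices of the host graph transported from `τ` by `φ`. -/
def pushLabel (τ : DecTree) {n : ℕ} (φ : Fin τ.n → Fin n) (x : Fin n) : ℕ :=
  ∑ u, if φ u = x then τ.label u else 0

/-- The embeddings of `τ` in `G` which transport the labels of `τ` to `m`. -/
def embeddings (τ : DecTree) {n : ℕ} (G : SimpleGraph (Fin n)) (m : Fin n → ℕ) :
    Finset (Fin τ.n → Fin n) :=
  univ.filter fun φ => (Function.Injective φ ∧ ∀ a b, τ.graph.Adj a b → G.Adj (φ a) (φ b)) ∧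
    pushLabel τ φ = m

/-- The product over the vertices of the falling factorial powers of the shifted degrees. -/
def fallingProd {n : ℕ} (d : Fin n → ℕ) (m : Fin n → ℕ) : ℝ :=
  ∏ x, ((d x).descFactorial (m x) : ℝ)

lemma fallingProd_nonneg {n : ℕ} (d m : Fin n → ℕ) : 0 ≤ fallingProd d m :=
  prod_nonneg fun _ _ => Nat.cast_nonneg _

lemma pushLabel_mem_labelings (τ : DecTree) {n : ℕ} (φ : Fin τ.n → Fin n) :
    pushLabel τ φ ∈ labelings n τ.weight := by
  rw [mem_labelings]
  simp only [pushLabel]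
  rw [sum_comm]
  simp [DecTree.weight]

lemma labelSupp_pushLabel (τ : DecTree) {n : ℕ} (φ : Fin τ.n → Fin n) :
    labelSupp (pushLabel τ φ) = univ.image φ := by
  ext x
  simp only [mem_labelSupp, pushLabel, mem_image, mem_univ, true_and, ne_eq, sum_eq_zero_iff,
    true_implies, not_forall, ite_eq_right_iff]
  refine exists_congr fun u => ?_
  have := τ.label_pos u
  constructor
  · rintro ⟨h, -⟩
    exact h
  · intro h
    exact ⟨h, this.ne'⟩

lemma fallingProd_pushLabel (τ : DecTree) {n : ℕ} (d : Fin n → ℕ) {φ : Fin τ.n → Fin n}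
    (hφ : Function.Injective φ) :
    fallingProd d (pushLabel τ φ) = ∏ u, ((d (φ u)).descFactorial (τ.label u) : ℝ) := by
  have h : ∀ u, pushLabel τ φ (φ u) = τ.label u := by
    intro u
    simp [pushLabel, hφ.eq_iff]
  rw [fallingProd, ← prod_subset (subset_univ (univ.image φ)), prod_image hφ.injOn]
  · simp only [h]
  · intro x _ hx
    rw [← labelSupp_pushLabel, mem_labelSupp, not_not] at hx
    simp [hx]

lemma Dval_eq_sum (τ : DecTree) {n : ℕ} (G : SimpleGraph (Fin n)) :
    Dval τ G = ∑ m ∈ labelings n τ.weight, #(embeddings τ G m) * fallingProd (deg G) m := by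
  rw [Dval, ← sum_filter, ← sum_fiberwise_of_maps_to
    (fun φ _ => pushLabel_mem_labelings τ φ)]
  refine sum_congr rfl fun m _ => ?_
  rw [filter_filter, embeddings, ← nsmul_eq_mul, ← sum_const]
  refine sum_congr (by congr) fun φ hφ => ?_
  rw [mem_filter] at hφ
  rw [← hφ.2.2, fallingProd_pushLabel _ _ hφ.2.1.1]

lemma card_embeddings_le (τ : DecTree) {n : ℕ} (G : SimpleGraph (Fin n)) (m : Fin n → ℕ) :
    #(embeddings τ G m) ≤ τ.weight ^ τ.n := by
  by_cases hm : m ∈ labelings n τ.weight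
  · calc #(embeddings τ G m) ≤ #(Fintype.piFinset fun _ : Fin τ.n => labelSupp m) := by
          refine card_le_card fun φ hφ => ?_
          rw [embeddings, mem_filter] at hφ
          rw [Fintype.mem_piFinset, ← hφ.2.2, labelSupp_pushLabel]
          exact fun u => mem_image_of_mem _ (mem_univ _)
      _ = #(labelSupp m) ^ τ.n := by simp
      _ ≤ _ := Nat.pow_le_pow_left (card_labelSupp_le hm) _
  · have : embeddings τ G m = ∅ := by
      refine eq_empty_of_forall_notMem fun φ hφ => hm ?_
      rw [embeddings, mem_filter] at hφ
      exact hφ.2.2 ▸ pushLabel_mem_labelings τ φ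
    simp [this]

lemma uncut_of_embeddings {τ : DecTree} {n : ℕ} {G : SimpleGraph (Fin n)} {m : Fin n → ℕ}
    (h : #(embeddings τ G m) ≠ 0) : Uncut G (labelSupp m) := by
  obtain ⟨φ, hφ⟩ := card_ne_zero.1 h
  rw [embeddings, mem_filter] at hφ
  rw [← hφ.2.2, labelSupp_pushLabel]
  exact uncut_image τ.isTree.1 hφ.2.1.2

lemma pushLabel_castSucc (τ : DecTree) {n : ℕ} (φ : Fin τ.n → Fin n) :
    pushLabel τ (fun u => (φ u).castSucc) = extendLabel (pushLabel τ φ) 0 := by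
  ext x
  refine Fin.lastCases ?_ (fun x => ?_) x
  · simp [pushLabel, (Fin.castSucc_lt_last _).ne]
  · simp [pushLabel]

lemma card_embeddings_attach (τ : DecTree) {n : ℕ} (G : SimpleGraph (Fin n)) (v : Fin n)
    (m : Fin n → ℕ) :
    #(embeddings τ (attach G v) (extendLabel m 0)) = #(embeddings τ G m) := by
  symm
  refine card_bij (fun φ _ u => (φ u).castSucc) ?_ ?_ ?_
  · intro φ hφ
    simp only [embeddings, mem_filter, mem_univ, true_and] at hφ ⊢
    obtain ⟨⟨h1, h2⟩, h3⟩ := hφ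
    refine ⟨⟨(Fin.castSucc_injective n).comp h1, fun a b hab => ?_⟩, ?_⟩
    · exact (attach_adj_castSucc _ _ _ _).2 (h2 a b hab)
    · rw [pushLabel_castSucc, h3]
  · intro φ _ φ' _ h
    funext u
    exact Fin.castSucc_injective n (congrFun h u)
  · intro φ hφ
    simp only [embeddings, mem_filter, mem_univ, true_and] at hφ
    obtain ⟨⟨h1, h2⟩, h3⟩ := hφ
    have hne : ∀ u, φ u ≠ Fin.last n := by
      intro u hu
      have : φ u ∈ labelSupp (extendLabel m 0) := by
        rw [← h3, labelSupp_pushLabel]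
        exact mem_image_of_mem _ (mem_univ _)
      rw [hu, mem_labelSupp, extendLabel_last] at this
      exact this rfl
    choose ψ hψ using fun u => Fin.exists_castSucc_eq.2 (hne u)
    obtain rfl : (fun u => (ψ u).castSucc) = φ := funext hψ
    refine ⟨ψ, ?_, rfl⟩
    simp only [embeddings, mem_filter, mem_univ, true_and]
    refine ⟨⟨fun a b hab => h1 (congrArg Fin.castSucc hab), fun a b hab => ?_⟩, ?_⟩
    · exact (attach_adj_castSucc _ _ _ _).1 (h2 a b hab)
    · rw [pushLabel_castSucc] at h3
      funext x
      simpa using congrFun h3 x.castSucc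

/-! ### Bounds on the increments -/

/-- The product over the vertices of the rising factorial powers of the degrees, restricted to
labelings whose support is connected once `v` is added. -/
def linkTerm {n : ℕ} (G : SimpleGraph (Fin n)) (v : Fin n) (m : Fin n → ℕ) : ℝ :=
  if Uncut G (labelSupp (m + Pi.single v 1)) then risingProd G m else 0

lemma linkTerm_nonneg {n : ℕ} (G : SimpleGraph (Fin n)) (v : Fin n) (m : Fin n → ℕ) :
    0 ≤ linkTerm G v m := by
  rw [linkTerm]
  split_ifs
  exacts [risingProd_nonneg _ _, le_rfl]

lemma sum_labelings_eq_sum_add_single {n : ℕ} (s : ℕ) (v : Fin n) {t : (Fin n → ℕ) → ℝ}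
    (ht : ∀ m, m v = 0 → t m = 0) :
    ∑ m ∈ labelings n (s + 1), t m = ∑ m ∈ labelings n s, t (m + Pi.single v 1) := by
  rw [← sum_image (g := fun m => m + Pi.single v 1) (f := t)
    (fun a _ b _ h => add_right_cancel h)]
  symm
  refine sum_subset ?_ fun m hm hm' => ht m ?_
  · intro m' hm'
    obtain ⟨m, hm, rfl⟩ := mem_image.1 hm'
    exact add_mem_labelings hm (single_mem_labelings v)
  · by_contra hv
    apply hm'
    have hle : Pi.single v 1 ≤ m := by
      intro x
      by_cases hx : x = v
      · subst hx
        simpa using Nat.one_le_iff_ne_zero.2 hv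
      · simp [hx]
    refine mem_image.2 ⟨m - Pi.single v 1, ?_, tsub_add_cancel_of_le hle⟩
    have h1 := mem_labelings.1 (single_mem_labelings v)
    rw [mem_labelings] at hm ⊢
    rw [← tsub_add_cancel_of_le hle] at hm
    simp only [Pi.add_apply, sum_add_distrib] at hm
    omega

lemma fallingProd_shift_of_eq_zero {n : ℕ} (G : SimpleGraph (Fin n)) (v : Fin n)
    {m : Fin n → ℕ} (hm : m v = 0) :
    fallingProd (fun x => deg G x + if x = v then 1 else 0) m = fallingProd (deg G) m := by
  refine prod_congr rfl fun x _ => ?_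
  by_cases hx : x = v
  · simp [hx, hm]
  · simp [hx]

lemma fallingProd_shift_sub {n : ℕ} (G : SimpleGraph (Fin n)) (v : Fin n) (m : Fin n → ℕ) :
    fallingProd (fun x => deg G x + if x = v then 1 else 0) (m + Pi.single v 1) -
      fallingProd (deg G) (m + Pi.single v 1) = (m v + 1 : ℕ) * fallingProd (deg G) m := by
  have h1 : ∏ x ∈ univ.erase v,
      ((deg G x + if x = v then 1 else 0).descFactorial ((m + Pi.single v 1 : Fin n → ℕ) x) : ℝ) =
      ∏ x ∈ univ.erase v, ((deg G x).descFactorial (m x) : ℝ) :=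
    prod_congr rfl fun x hx => by simp [ne_of_mem_erase hx]
  have h2 : ∏ x ∈ univ.erase v,
      ((deg G x).descFactorial ((m + Pi.single v 1 : Fin n → ℕ) x) : ℝ) =
      ∏ x ∈ univ.erase v, ((deg G x).descFactorial (m x) : ℝ) :=
    prod_congr rfl fun x hx => by simp [ne_of_mem_erase hx]
  simp only [fallingProd]
  rw [← mul_prod_erase univ (fun x => ((deg G x).descFactorial (m x) : ℝ)) (mem_univ v)]
  conv_lhs =>
    congr
    · rw [← mul_prod_erase univ _ (mem_univ v)]
    · rw [← mul_prod_erase univ _ (mem_univ v)]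
  rw [h1, h2, ← sub_mul, if_pos rfl, Pi.add_apply, Pi.single_eq_same, succ_descFactorial_add]
  push_cast
  ring

lemma fallingProd_le_risingProd {n : ℕ} (G : SimpleGraph (Fin n)) (m : Fin n → ℕ) :
    fallingProd (deg G) m ≤ risingProd G m :=
  prod_le_prod (fun _ _ => Nat.cast_nonneg _) fun _ _ =>
    Nat.cast_le.2 (descFactorial_le_ascFactorial _ _)

lemma fallingProd_shift_le {n : ℕ} (G : SimpleGraph (Fin n)) {v : Fin n} (hv : 0 < deg G v)
    {m : Fin n → ℕ} (hm : m v ≠ 0) :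
    fallingProd (fun x => deg G x + if x = v then 1 else 0) m ≤ 2 * risingProd G m := by
  obtain ⟨c, hc⟩ := Nat.exists_eq_succ_of_ne_zero hm
  rw [fallingProd, risingProd, ← mul_prod_erase univ _ (mem_univ v)]
  conv_rhs => rw [← mul_prod_erase univ _ (mem_univ v)]
  rw [prod_erase_ite G v fun d x => (d.descFactorial (m x) : ℝ), ← mul_assoc, if_pos rfl, hc]
  refine mul_le_mul ?_ ?_ (prod_nonneg fun _ _ => Nat.cast_nonneg _) (by positivity)
  · exact_mod_cast succ_descFactorial_le hv c
  · exact prod_le_prod (fun _ _ => Nat.cast_nonneg _) fun _ _ =>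
      Nat.cast_le.2 (descFactorial_le_ascFactorial _ _)

lemma fallingProd_attach_extendLabel {n : ℕ} (G : SimpleGraph (Fin n)) (v : Fin n)
    (m : Fin n → ℕ) (j : ℕ) :
    fallingProd (deg (attach G v)) (extendLabel m j) =
      (Nat.descFactorial 1 j : ℕ) *
        fallingProd (fun x => deg G x + if x = v then 1 else 0) m := by
  rw [fallingProd, Fin.prod_univ_castSucc]
  simp only [deg_attach_castSucc, deg_attach_last, extendLabel_castSucc, extendLabel_last]
  rw [mul_comm, fallingProd]

lemma Dval_attach_sub (τ : DecTree) {s : ℕ} (hs : τ.weight = s + 1) {n : ℕ}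
    (G : SimpleGraph (Fin n)) (v : Fin n) :
    Dval τ (attach G v) - Dval τ G =
      ∑ m ∈ labelings n s, (#(embeddings τ G (m + Pi.single v 1)) *
          ((m v + 1 : ℕ) * fallingProd (deg G) m) +
        #(embeddings τ (attach G v) (extendLabel m 1)) *
          fallingProd (fun x => deg G x + if x = v then 1 else 0) m) := by
  have h0 : ∑ m ∈ labelings n (s + 1), (#(embeddings τ G m) : ℝ) *
      (fallingProd (fun x => deg G x + if x = v then 1 else 0) m - fallingProd (deg G) m) =
      ∑ m ∈ labelings n s, #(embeddings τ G (m + Pi.single v 1)) *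
          ((m v + 1 : ℕ) * fallingProd (deg G) m) := by
    rw [sum_labelings_eq_sum_add_single s v]
    · simp only [fallingProd_shift_sub]
    · intro m hm
      rw [fallingProd_shift_of_eq_zero G v hm, sub_self, mul_zero]
  have h2 : ∀ j ∈ range s, ∑ m ∈ labelings n (s + 1 - (j + 1 + 1)),
      (#(embeddings τ (attach G v) (extendLabel m (j + 1 + 1))) : ℝ) *
        fallingProd (deg (attach G v)) (extendLabel m (j + 1 + 1)) = 0 := by
    intro j _
    refine sum_eq_zero fun m _ => ?_
    rw [fallingProd_attach_extendLabel, Nat.descFactorial_of_lt (by omega)]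
    simp
  rw [Dval_eq_sum, Dval_eq_sum, hs, sum_labelings_succ, sum_range_succ', sum_range_succ',
    sum_eq_zero h2, sum_add_distrib, ← h0]
  simp only [mul_sub, sum_sub_distrib, fallingProd_attach_extendLabel, card_embeddings_attach,
    zero_add, Nat.sub_zero, Nat.descFactorial_zero, Nat.descFactorial_one, Nat.cast_one, one_mul,
    Nat.add_sub_cancel]
  ring

lemma Dval_attach_sub_nonneg (τ : DecTree) {s : ℕ} (hs : τ.weight = s + 1) {n : ℕ}
    (G : SimpleGraph (Fin n)) (v : Fin n) : 0 ≤ Dval τ (attach G v) - Dval τ G := by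
  rw [Dval_attach_sub τ hs]
  refine sum_nonneg fun m _ => ?_
  have h1 := fallingProd_nonneg (deg G) m
  have h2 := fallingProd_nonneg (fun x => deg G x + if x = v then 1 else 0) m
  positivity

lemma Dval_attach_sub_le (τ : DecTree) {s : ℕ} (hs : τ.weight = s + 1) (hs0 : s ≠ 0) {n : ℕ}
    (G : SimpleGraph (Fin n)) {v : Fin n} (hv : 0 < deg G v) :
    Dval τ (attach G v) - Dval τ G ≤
      (τ.weight ^ τ.n * (s + 3) : ℕ) * ∑ m ∈ labelings n s, linkTerm G v m := by
  rw [Dval_attach_sub τ hs, mul_sum]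
  refine sum_le_sum fun m hm => ?_
  have hmv : m v ≤ s := by
    rw [← mem_labelings.1 hm]
    exact single_le_sum (f := m) (fun _ _ => Nat.zero_le _) (mem_univ v)
  have hL := linkTerm_nonneg G v m
  have h1 : (#(embeddings τ G (m + Pi.single v 1)) : ℝ) *
      ((m v + 1 : ℕ) * fallingProd (deg G) m) ≤
      (τ.weight ^ τ.n : ℕ) * ((s + 1 : ℕ) * linkTerm G v m) := by
    by_cases h : #(embeddings τ G (m + Pi.single v 1)) = 0
    · rw [h, Nat.cast_zero, zero_mul]
      positivity
    · rw [linkTerm, if_pos (uncut_of_embeddings h)]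
      have := fallingProd_nonneg (deg G) m
      have := risingProd_nonneg G m
      gcongr
      · exact card_embeddings_le _ _ _
      · exact fallingProd_le_risingProd G m
  have h2 : (#(embeddings τ (attach G v) (extendLabel m 1)) : ℝ) *
      fallingProd (fun x => deg G x + if x = v then 1 else 0) m ≤
      (τ.weight ^ τ.n : ℕ) * (2 * linkTerm G v m) := by
    by_cases h : #(embeddings τ (attach G v) (extendLabel m 1)) = 0
    · rw [h, Nat.cast_zero, zero_mul]
      positivity
    · have hu := uncut_of_embeddings h
      rw [labelSupp_extendLabel_pos m one_ne_zero] at hu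
      have hne : (labelSupp m).Nonempty := by
        rw [mem_labelings] at hm
        obtain ⟨x, -, hx⟩ := exists_ne_zero_of_sum_ne_zero (s := univ) (f := m) (by omega)
        exact ⟨x, mem_labelSupp.2 hx⟩
      have hmem := mem_of_uncut_attach hne hu
      rw [linkTerm, labelSupp_add_single_of_mem hmem, if_pos (uncut_of_attach_insert hu)]
      have := fallingProd_nonneg (fun x => deg G x + if x = v then 1 else 0) m
      have := risingProd_nonneg G m
      have := fallingProd_shift_le G hv (mem_labelSupp.1 hmem)
      gcongr
      exact card_embeddings_le _ _ _
  refine (add_le_add h1 h2).trans (le_of_eq ?_)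
  push_cast
  ring

lemma sum_deg_mul_increment_sq_le (τ : DecTree) {s : ℕ} (hs : τ.weight = s + 1) (hs0 : s ≠ 0) :
    ∃ K : ℝ, 0 ≤ K ∧ ∀ {n : ℕ} (G : SimpleGraph (Fin n)),
      ∑ v, (deg G v : ℝ) * (Dval τ (attach G v) - Dval τ G) ^ 2 ≤
        K * ∑ i ∈ range (2 * s + 2), moment G (2 * s + 1) i := by
  obtain ⟨c, hc0, hc⟩ : ∃ c : ℝ, 0 ≤ c ∧ ∀ {n : ℕ} (G : SimpleGraph (Fin n)) {v : Fin n},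
      0 < deg G v →
        Dval τ (attach G v) - Dval τ G ≤ c * ∑ m ∈ labelings n s, linkTerm G v m :=
    ⟨_, Nat.cast_nonneg _, fun G _ hv => Dval_attach_sub_le τ hs hs0 G hv⟩
  refine ⟨c ^ 2 * (2 ^ (s + s) : ℕ) * (s + s + 1 : ℕ), by positivity, fun {n} G => ?_⟩
  obtain ⟨F, hF⟩ : ∃ F : (Fin n → ℕ) → ℝ,
      F = fun m => if Uncut G (labelSupp m) then risingProd G m else 0 := ⟨_, rfl⟩
  have hF0 : ∀ m, 0 ≤ F m := by
    intro m
    simp only [hF]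
    split_ifs
    exacts [risingProd_nonneg _ _, le_rfl]
  have hpair : ∀ (v : Fin n) (m m' : Fin n → ℕ),
      (deg G v : ℝ) * (linkTerm G v m * linkTerm G v m') ≤ F (m + m' + Pi.single v 1) := by
    intro v m m'
    by_cases h : Uncut G (labelSupp (m + Pi.single v 1)) ∧ Uncut G (labelSupp (m' + Pi.single v 1))
    · have hu : Uncut G (labelSupp (m + m' + Pi.single v 1)) := by
        have := h.1.union h.2 (v := v) (by simp [mem_labelSupp]) (by simp [mem_labelSupp])
        convert this using 1
        simp only [labelSupp_add]
        ext x
        simp only [mem_union]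
        tauto
      simp only [hF]
      rw [linkTerm, linkTerm, if_pos h.1, if_pos h.2, if_pos hu]
      calc _ ≤ (deg G v : ℝ) * risingProd G (m + m') := by
            gcongr
            exact risingProd_mul_le _ _ _
        _ ≤ _ := deg_mul_risingProd_le _ _ _
    · have : linkTerm G v m * linkTerm G v m' = 0 := by
        rw [mul_eq_zero, linkTerm, linkTerm]
        rcases not_and_or.1 h with h | h
        · exact Or.inl (if_neg h)
        · exact Or.inr (if_neg h)
      rw [this, mul_zero]
      exact hF0 _
  have hvert : ∀ v : Fin n, (deg G v : ℝ) * (Dval τ (attach G v) - Dval τ G) ^ 2 ≤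
      c ^ 2 * ((2 ^ (s + s) : ℕ) * ∑ m ∈ labelings n (s + s), F (m + Pi.single v 1)) := by
    intro v
    rcases Nat.eq_zero_or_pos (deg G v) with hv | hv
    · rw [hv, Nat.cast_zero, zero_mul]
      have : 0 ≤ ∑ m ∈ labelings n (s + s), F (m + Pi.single v 1) :=
        sum_nonneg fun _ _ => hF0 _
      positivity
    · calc _ ≤ (deg G v : ℝ) * (c * ∑ m ∈ labelings n s, linkTerm G v m) ^ 2 := by
            have := Dval_attach_sub_nonneg τ hs G v
            have := hc G hv
            gcongr
        _ = c ^ 2 * ∑ m ∈ labelings n s, ∑ m' ∈ labelings n s,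
            (deg G v : ℝ) * (linkTerm G v m * linkTerm G v m') := by
            simp only [← mul_sum]
            rw [← sum_mul]
            ring
        _ ≤ c ^ 2 * ∑ m ∈ labelings n s, ∑ m' ∈ labelings n s, F (m + m' + Pi.single v 1) := by
            gcongr
            exact hpair _ _ _
        _ ≤ _ := mul_le_mul_of_nonneg_left (sum_sum_add_add_le s s hF0 (Pi.single v 1)) (sq_nonneg c)
  have hmoment : ∑ m ∈ labelings n (s + s + 1), F m =
      ∑ i ∈ range (2 * s + 2), moment G (2 * s + 1) i := by
    rw [← two_mul]
    simp only [moment]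
    rw [sum_comm]
    refine sum_congr rfl fun m hm => ?_
    have hcard := card_labelSupp_le hm
    rw [sum_eq_single #(labelSupp m)]
    · simp [hF, momentTerm]
    · intro i _ hi
      rw [momentTerm, if_neg fun h => hi h.1.symm]
    · intro h
      exact absurd (mem_range.2 (by omega)) h
  calc _ ≤ ∑ v, c ^ 2 * ((2 ^ (s + s) : ℕ) * ∑ m ∈ labelings n (s + s), F (m + Pi.single v 1)) :=
        sum_le_sum fun v _ => hvert v
    _ = c ^ 2 * ((2 ^ (s + s) : ℕ) *
        ∑ v, ∑ m ∈ labelings n (s + s), F (m + Pi.single v 1)) := by simp only [mul_sum]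
    _ ≤ c ^ 2 * ((2 ^ (s + s) : ℕ) * ((s + s + 1 : ℕ) * ∑ m ∈ labelings n (s + s + 1), F m)) := by
        gcongr
        exact sum_add_single_le _ hF0
    _ = _ := by
        rw [hmoment]
        ring

/-! ### Expected squared increments -/

lemma lawAt_add {n₀ : ℕ} (S : SimpleGraph (Fin n₀)) (k : ℕ) (G : SimpleGraph (Fin (n₀ + k))) :
    lawAt S (n₀ + k) G = law S k G := by
  rw [lawAt, dif_pos (Nat.le_add_right _ _)]
  have h : ∀ (k' : ℕ) (hk : k' = k)
      (e : SimpleGraph (Fin (n₀ + k)) = SimpleGraph (Fin (n₀ + k'))),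
      law S k' (cast e G) = law S k G := by
    rintro k' rfl e
    rfl
  exact h _ (Nat.add_sub_cancel_left _ _) _

lemma expIncrSq_eq_expect {n₀ : ℕ} (S : SimpleGraph (Fin n₀)) (τ : DecTree) (k : ℕ) :
    expIncrSq S τ (n₀ + k) = expect S k fun G =>
      (∑ v, (deg G v : ℝ) * (Dval τ (attach G v) - Dval τ G) ^ 2) /
        (2 * (n₀ + k : ℕ) - 2) := by
  rw [expIncrSq, expect]
  refine Finset.sum_congr (by congr) fun G _ => ?_
  rw [sum_div, mul_sum]
  refine sum_congr rfl fun v _ => ?_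
  rw [lawAt_add]
  ring

lemma expIncrSq_le (τ : DecTree) (hw : 1 < τ.weight) {n₀ : ℕ} {S : SimpleGraph (Fin n₀)}
    (hS : S.IsTree) (hn₀ : 2 ≤ n₀) :
    ∃ C : ℝ, 0 ≤ C ∧ ∃ j : ℕ, ∀ k, expIncrSq S τ (n₀ + k) ≤
      C * ((n₀ - 1 + k : ℕ) : ℝ) ^ ((τ.weight : ℝ) - 3 / 2) *
        harmonicSucc (n₀ - 1 + k) ^ j := by
  obtain ⟨s, hs⟩ := Nat.exists_eq_add_of_le' hw.le
  have hs0 : s ≠ 0 := by omega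
  obtain ⟨K, hK0, hK⟩ := sum_deg_mul_increment_sq_le τ hs hs0
  choose C hC0 hC using fun i => expect_moment_le hn₀ hS i (2 * s + 1) (by omega)
  have hsum0 : 0 ≤ ∑ i ∈ range (2 * s + 2), C i := sum_nonneg fun i _ => hC0 i
  refine ⟨K * ∑ i ∈ range (2 * s + 2), C i, by positivity, 2 * s + 2, fun k => ?_⟩
  have hN : 0 < n₀ - 1 + k := by omega
  have hN2 : (2 : ℝ) * (n₀ + k : ℕ) - 2 = 2 * (n₀ - 1 + k : ℕ) := by
    have : n₀ + k = (n₀ - 1 + k) + 1 := by omega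
    rw [this]
    push_cast
    ring
  have hL := one_le_harmonicSucc (n₀ - 1 + k)
  have hexp : expIncrSq S τ (n₀ + k) ≤ K / (2 * (n₀ - 1 + k : ℕ)) *
      ∑ i ∈ range (2 * s + 2), expect S k fun G => moment G (2 * s + 1) i := by
    rw [expIncrSq_eq_expect, hN2, ← expect_sum, ← expect_const_mul]
    refine expect_mono hn₀ hS k fun G _ => ?_
    rw [div_mul_eq_mul_div]
    gcongr
    exact hK G
  have hmom : ∑ i ∈ range (2 * s + 2), expect S k (fun G => moment G (2 * s + 1) i) ≤
      (∑ i ∈ range (2 * s + 2), C i) * ((n₀ - 1 + k : ℕ) : ℝ) ^ (((2 * s + 1 : ℕ) : ℝ) / 2) *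
        harmonicSucc (n₀ - 1 + k) ^ (2 * s + 2) := by
    rw [sum_mul, sum_mul]
    refine sum_le_sum fun i hi => (hC i k).trans ?_
    have := hC0 i
    gcongr
    exact (mem_range.1 hi).le
  generalize n₀ - 1 + k = N at *
  have hN' : (0 : ℝ) < N := by exact_mod_cast hN
  have hpow : (N : ℝ) ^ (((2 * s + 1 : ℕ) : ℝ) / 2) = (N : ℝ) ^ ((τ.weight : ℝ) - 3 / 2) * N := by
    rw [← Real.rpow_add_one hN'.ne', hs]
    congr 1
    push_cast
    ring
  rw [hpow] at hmom
  have hX : 0 ≤ K * (∑ i ∈ range (2 * s + 2), C i) * (N : ℝ) ^ ((τ.weight : ℝ) - 3 / 2) *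
      harmonicSucc N ^ (2 * s + 2) := by positivity
  calc _ ≤ K / (2 * N) * ((∑ i ∈ range (2 * s + 2), C i) *
        ((N : ℝ) ^ ((τ.weight : ℝ) - 3 / 2) * N) * harmonicSucc N ^ (2 * s + 2)) := by
        refine hexp.trans ?_
        gcongr
    _ = K * (∑ i ∈ range (2 * s + 2), C i) * (N : ℝ) ^ ((τ.weight : ℝ) - 3 / 2) *
        harmonicSucc N ^ (2 * s + 2) / 2 := by field_simp
    _ ≤ _ := by linarith

lemma expIncrSq_nonneg {n₀ : ℕ} (hn₀ : 2 ≤ n₀) (S : SimpleGraph (Fin n₀)) (τ : DecTree) (k : ℕ) :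
    0 ≤ expIncrSq S τ (n₀ + k) := by
  rw [expIncrSq_eq_expect]
  refine expect_nonneg hn₀ S k fun G => div_nonneg (sum_nonneg fun v _ => by positivity) ?_
  have : (2 : ℝ) ≤ (n₀ + k : ℕ) := by exact_mod_cast (by omega : 2 ≤ n₀ + k)
  linarith

end Auxiliary

/-- For every decorated tree `τ` with `w(τ) > 1` and every seed tree `S`, the squared increments
satisfy `E[(D_τ(T_{n+1}^{(S)}) − D_τ(T_n^{(S)}))²] ≪ n^{w(τ) − 3/2}`. -/
theorem squared_increment_bound (τ : DecTree) (hw : 1 < τ.weight)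
    {n₀ : ℕ} (S : SimpleGraph (Fin n₀)) (hS : S.IsTree) (hn₀ : 2 ≤ n₀) :
    Lsim (fun n => expIncrSq S τ n)
      (fun n => (n : ℝ) ^ ((τ.weight : ℝ) - 3 / 2)) := by
  obtain ⟨C, hC0, j, hC⟩ := expIncrSq_le τ hw hS hn₀
  refine ⟨C * 3 ^ j + 1, j, by positivity, ?_⟩
  filter_upwards [Filter.eventually_ge_atTop (n₀ + 3)] with n hn
  obtain ⟨k, rfl⟩ := Nat.exists_eq_add_of_le (by omega : n₀ ≤ n)
  have hw' : (2 : ℝ) ≤ τ.weight := by exact_mod_cast hw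
  have hn3 : (3 : ℝ) ≤ (n₀ + k : ℕ) := by exact_mod_cast (by omega : 3 ≤ n₀ + k)
  have hlog : 1 ≤ Real.log (n₀ + k : ℕ) := by
    rw [Real.le_log_iff_exp_le (by linarith)]
    linarith [Real.exp_one_lt_three]
  have hNn : ((n₀ - 1 + k : ℕ) : ℝ) ≤ (n₀ + k : ℕ) := by
    exact_mod_cast (by omega : n₀ - 1 + k ≤ n₀ + k)
  have hN : (0 : ℝ) < (n₀ - 1 + k : ℕ) := by exact_mod_cast (by omega : 0 < n₀ - 1 + k)
  have hL := one_le_harmonicSucc (n₀ - 1 + k)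
  have hLn : harmonicSucc (n₀ - 1 + k) ≤ 3 * Real.log (n₀ + k : ℕ) := by
    have h1 := harmonicSucc_le (n₀ - 1 + k)
    have h2 := Real.log_le_log hN hNn
    linarith
  rw [abs_of_nonneg (expIncrSq_nonneg hn₀ S τ k), abs_of_nonneg (by positivity),
    Real.rpow_natCast]
  calc expIncrSq S τ (n₀ + k) ≤ C * ((n₀ - 1 + k : ℕ) : ℝ) ^ ((τ.weight : ℝ) - 3 / 2) *
        harmonicSucc (n₀ - 1 + k) ^ j := hC k
    _ ≤ C * ((n₀ + k : ℕ) : ℝ) ^ ((τ.weight : ℝ) - 3 / 2) *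
        (3 * Real.log (n₀ + k : ℕ)) ^ j := by
        gcongr
        linarith
    _ = C * 3 ^ j * Real.log (n₀ + k : ℕ) ^ j *
        ((n₀ + k : ℕ) : ℝ) ^ ((τ.weight : ℝ) - 3 / 2) := by ring
    _ ≤ _ := by
        gcongr
        linarith

end LPAM
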